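/- arXiv:2203.00550 — 5 statements merged into one kernel-verified Lean document; each statement's English description precedes it below -/
import Mathlib

section
/- Let U be a multivariate time series with p = 1 channel of length n, i.e. a single time series x = (x_1, …, x_n), with interaction graph I_1 consisting of a single vertex with no edges. Then for every embedding dimension m ≥ 2 and delay L ≥ 1 with n > (m−1)L, the multivariate permutation entropy of U equals the (univariate) permutation entropy of x: MPE_G(U; m, L) = PE(x; m, L). -/
open Finset

section PEdefs

variable {V : Type*} [Fintype V] [DecidableEq V]

/-- One step of out-neighbourhood expansion in a (di)graph given by adjacency `A`. -/
def stepSet (A : V → V → Prop) [DecidableRel A] (S : Finset V) : Finset V :=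
  S.biUnion fun v => Finset.univ.filter (A v)

/-- `Nk A k i` : the set of vertices reachable from `i` by a walk traversing exactly
`k` arcs/edges. -/
def Nk (A : V → V → Prop) [DecidableRel A] (k : ℕ) (i : V) : Finset V :=
  (stepSet A)^[k] {i}

/-- The averaged signal value `y_i^k`. -/
noncomputable def yval (A : V → V → Prop) [DecidableRel A] (x : V → ℝ) (k : ℕ) (i : V) : ℝ :=
  (∑ j ∈ Nk A k i, x j) / ((Nk A k i).card : ℝ)

/-- The graph embedding vector `(y_i^0, y_i^L, …, y_i^{(m-1)L})` at vertex `i`. -/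
noncomputable def gembed (A : V → V → Prop) [DecidableRel A] (x : V → ℝ) (m L : ℕ) (i : V) :
    Fin m → ℝ :=
  fun k => yval A x ((k : ℕ) * L) i

/-- The embedding vector of dimension `m` and delay `L` is defined at `i`, i.e. all needed
neighbourhoods are nonempty. -/
def gdefined (A : V → V → Prop) [DecidableRel A] (m L : ℕ) (i : V) : Prop :=
  ∀ k ∈ Finset.Icc 1 (m - 1), (Nk A (k * L) i).Nonempty

instance (A : V → V → Prop) [DecidableRel A] (m L : ℕ) :
    DecidablePred (gdefined A m L) := fun i => by
  unfold gdefined; infer_instance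

end PEdefs

/-- The ordinal pattern of a real vector: the permutation sorting it increasingly,
ties broken by smaller index first. -/
noncomputable def pattern {m : ℕ} (z : Fin m → ℝ) : Equiv.Perm (Fin m) :=
  Tuple.sort z

/-- Permutation entropy for graph signals, `PE_G`. -/
noncomputable def PEG {V : Type*} [Fintype V] [DecidableEq V]
    (A : V → V → Prop) [DecidableRel A] (x : V → ℝ) (m L : ℕ) : ℝ :=
  -(1 / Real.log (Nat.factorial m)) *
    ∑ π : Equiv.Perm (Fin m),
      ((((Finset.univ.filter (gdefined A m L)).filter
            (fun i => pattern (gembed A x m L i) = π)).card : ℝ) /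
          ((Finset.univ.filter (gdefined A m L)).card : ℝ)) *
        Real.log ((((Finset.univ.filter (gdefined A m L)).filter
            (fun i => pattern (gembed A x m L i) = π)).card : ℝ) /
          ((Finset.univ.filter (gdefined A m L)).card : ℝ))

/-- The classical delay embedding vector `(x_i, x_{i+L}, …, x_{i+(m-1)L})` (0-based). -/
def tembed (x : ℕ → ℝ) (m L i : ℕ) : Fin m → ℝ := fun k => x (i + (k : ℕ) * L)

/-- Classical (univariate) permutation entropy of the time series `x_0, …, x_{n-1}`. -/
noncomputable def PE (x : ℕ → ℝ) (n m L : ℕ) : ℝ :=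
  -(1 / Real.log (Nat.factorial m)) *
    ∑ π : Equiv.Perm (Fin m),
      ((((Finset.range (n - (m - 1) * L)).filter
            (fun i => pattern (tembed x m L i) = π)).card : ℝ) /
          ((n - (m - 1) * L : ℕ) : ℝ)) *
        Real.log ((((Finset.range (n - (m - 1) * L)).filter
            (fun i => pattern (tembed x m L i) = π)).card : ℝ) /
          ((n - (m - 1) * L : ℕ) : ℝ))

/-- The directed path on `n` vertices: arcs `i → i+1`. -/
def pathAdj (n : ℕ) : Fin n → Fin n → Prop := fun i j => (i : ℕ) + 1 = (j : ℕ)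

instance (n : ℕ) : DecidableRel (pathAdj n) := fun i j => by
  unfold pathAdj; infer_instance

/-- Cartesian product of two (di)graphs given by adjacency relations. -/
def cartAdj {V W : Type*} (A : V → V → Prop) (B : W → W → Prop) :
    V × W → V × W → Prop :=
  fun a b => (a.1 = b.1 ∧ B a.2 b.2) ∨ (a.2 = b.2 ∧ A a.1 b.1)

instance {V W : Type*} [DecidableEq V] [DecidableEq W] (A : V → V → Prop) (B : W → W → Prop)
    [DecidableRel A] [DecidableRel B] : DecidableRel (cartAdj A B) := fun a b => by
  unfold cartAdj; infer_instance

/-- The edgeless graph on `p` vertices. -/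
def noEdges (p : ℕ) : Fin p → Fin p → Prop := fun _ _ => False

instance (p : ℕ) : DecidableRel (noEdges p) := fun _ _ => by
  unfold noEdges; infer_instance

/-- A vertex lies in the `k`-step neighbourhood in `P⃗_n □ I_1` iff its time index is shifted
by `k`. -/
lemma mem_Nk_path_single_channel {n : ℕ} (k : ℕ) (i j : Fin n × Fin 1) :
    j ∈ Nk (cartAdj (pathAdj n) (noEdges 1)) k i ↔ (j.1 : ℕ) = i.1 + k := by
  induction k generalizing j with
  | zero =>
    simp [Nk, Prod.ext_iff, Fin.ext_iff]
  | succ k ih =>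
    have hstep : Nk (cartAdj (pathAdj n) (noEdges 1)) (k + 1) i =
        stepSet (cartAdj (pathAdj n) (noEdges 1))
          (Nk (cartAdj (pathAdj n) (noEdges 1)) k i) := by
      simp only [Nk, Function.iterate_succ_apply']
    simp only [hstep, stepSet, mem_biUnion, ih, mem_filter, mem_univ, true_and]
    constructor
    · rintro ⟨v, hv, ⟨-, h⟩ | ⟨-, h⟩⟩
      · exact h.elim
      · have h' : (v.1 : ℕ) + 1 = j.1 := h
        omega
    · intro h
      refine ⟨(⟨i.1 + k, by omega⟩, j.2), rfl, Or.inr ⟨rfl, ?_⟩⟩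
      change (i.1 : ℕ) + k + 1 = j.1
      omega

lemma Nk_path_single_channel {n : ℕ} {k : ℕ} {i : Fin n × Fin 1} (h : (i.1 : ℕ) + k < n) :
    Nk (cartAdj (pathAdj n) (noEdges 1)) k i = {(⟨i.1 + k, h⟩, 0)} := by
  ext j
  simp [mem_Nk_path_single_channel, Prod.ext_iff, Fin.ext_iff]

lemma gdefined_path_single_channel_iff {n m L : ℕ} (hm : 2 ≤ m) (i : Fin n × Fin 1) :
    gdefined (cartAdj (pathAdj n) (noEdges 1)) m L i ↔ (i.1 : ℕ) < n - (m - 1) * L := by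
  constructor
  · intro h
    obtain ⟨j, hj⟩ := h (m - 1) (by simp; omega)
    rw [mem_Nk_path_single_channel] at hj
    omega
  · intro h k hk
    have hkL : k * L ≤ (m - 1) * L := Nat.mul_le_mul_right L (mem_Icc.mp hk).2
    rw [Nk_path_single_channel (by omega)]
    exact singleton_nonempty _

lemma gembed_path_single_channel {n m L : ℕ} (x : ℕ → ℝ) {i : Fin n × Fin 1}
    (h : (i.1 : ℕ) < n - (m - 1) * L) :
    gembed (cartAdj (pathAdj n) (noEdges 1)) (fun v : Fin n × Fin 1 => x v.1) m L i =
      tembed x m L i.1 := by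
  funext k
  have hkL : (k : ℕ) * L ≤ (m - 1) * L := Nat.mul_le_mul_right L (by omega)
  have hk : (i.1 : ℕ) + k * L < n := by omega
  simp [gembed, yval, tembed, Nk_path_single_channel hk]

/-- Forgetting the trivial channel identifies the admissible vertices of `P⃗_n □ I_1` with the
admissible starting times. -/
lemma image_filter_gdefined_path_single_channel {n m L : ℕ} (hm : 2 ≤ m) :
    (univ.filter (gdefined (cartAdj (pathAdj n) (noEdges 1)) m L)).image
      (fun v : Fin n × Fin 1 => (v.1 : ℕ)) = range (n - (m - 1) * L) := by
  ext t
  simp only [mem_image, mem_filter, mem_univ, true_and, mem_range,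
    gdefined_path_single_channel_iff hm]
  constructor
  · rintro ⟨v, hv, rfl⟩
    exact hv
  · intro ht
    exact ⟨(⟨t, by omega⟩, 0), ht, rfl⟩

lemma injective_time_single_channel (n : ℕ) :
    Function.Injective (fun v : Fin n × Fin 1 => (v.1 : ℕ)) :=
  fun _ _ h => Prod.ext (Fin.ext h) (Subsingleton.elim _ _)

lemma card_filter_pattern_path_single_channel {n m L : ℕ} (hm : 2 ≤ m) (x : ℕ → ℝ)
    (π : Equiv.Perm (Fin m)) :
    ((univ.filter (gdefined (cartAdj (pathAdj n) (noEdges 1)) m L)).filter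
      (fun i => pattern (gembed (cartAdj (pathAdj n) (noEdges 1))
        (fun v : Fin n × Fin 1 => x v.1) m L i) = π)).card =
    ((range (n - (m - 1) * L)).filter (fun i => pattern (tembed x m L i) = π)).card := by
  rw [← image_filter_gdefined_path_single_channel hm, filter_image,
    card_image_of_injective _ (injective_time_single_channel n)]
  congr 1
  refine filter_congr fun i hi => ?_
  rw [gembed_path_single_channel x
    ((gdefined_path_single_channel_iff hm i).mp (mem_filter.mp hi).2)]

/-- For a multivariate signal with a single channel (`p = 1`, interaction
graph a single vertex with no edges), the multivariate permutation entropy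
`MPE_G = PE_G` on `P⃗_n □ I_1` coincides with the classical permutation entropy of the
underlying time series. -/
theorem mpe_single_channel_eq_pe (n m L : ℕ) (hm : 2 ≤ m) (hL : 1 ≤ L)
    (hn : (m - 1) * L < n) (x : ℕ → ℝ) :
    PEG (cartAdj (pathAdj n) (noEdges 1)) (fun v : Fin n × Fin 1 => x v.1) m L
      = PE x n m L := by
  have hcard : (univ.filter (gdefined (cartAdj (pathAdj n) (noEdges 1)) m L)).card =
      n - (m - 1) * L := by
    rw [← card_image_of_injective _ (injective_time_single_channel n),
      image_filter_gdefined_path_single_channel hm, card_range]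
  simp only [PEG, PE, card_filter_pattern_path_single_channel hm, hcard]
end

section
/- Let U = {u_{t,s}}, t = 1, …, n, s = 1, …, p, be a multivariate time series whose channel-interaction graph I_p consists of p isolated vertices (no edges). Then for every embedding dimension m ≥ 2 and delay L ≥ 1 with n > (m−1)L, the multivariate permutation entropy equals the multivariate multiscale permutation entropy: MPE_G(U; m, L) = MMSPE(U; m, L). -/
open Finset

/-- Multivariate multiscale permutation entropy `MMSPE`: ordinal patterns are aggregated
over all `p` channels of the multivariate time series `u` (channel `s`, time `t ↦ u t s`,
0-based, of length `n`). -/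
noncomputable def MMSPE (p : ℕ) (u : ℕ → Fin p → ℝ) (n m L : ℕ) : ℝ :=
  -(1 / Real.log (Nat.factorial m)) *
    ∑ π : Equiv.Perm (Fin m),
      ((((Finset.univ ×ˢ Finset.range (n - (m - 1) * L)).filter
            (fun q : Fin p × ℕ => pattern (tembed (fun t => u t q.1) m L q.2) = π)).card : ℝ) /
          ((p * (n - (m - 1) * L) : ℕ) : ℝ)) *
        Real.log ((((Finset.univ ×ˢ Finset.range (n - (m - 1) * L)).filter
            (fun q : Fin p × ℕ => pattern (tembed (fun t => u t q.1) m L q.2) = π)).card : ℝ) /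
          ((p * (n - (m - 1) * L) : ℕ) : ℝ))

theorem mem_Nk_pathAdj_noEdges {n p : ℕ} (k : ℕ) (v w : Fin n × Fin p) :
    w ∈ Nk (cartAdj (pathAdj n) (noEdges p)) k v ↔ w.2 = v.2 ∧ (w.1 : ℕ) = v.1 + k := by
  induction k generalizing w with
  | zero => simp [Nk, Prod.ext_iff, Fin.ext_iff, and_comm]
  | succ k ih =>
    have hstep : Nk (cartAdj (pathAdj n) (noEdges p)) (k + 1) v
        = stepSet (cartAdj (pathAdj n) (noEdges p))
          (Nk (cartAdj (pathAdj n) (noEdges p)) k v) :=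
      Function.iterate_succ_apply' _ _ _
    simp only [hstep, stepSet, mem_biUnion, mem_filter, mem_univ, true_and, ih, cartAdj,
      pathAdj, noEdges, and_false, false_or]
    constructor
    · rintro ⟨a, ⟨h₁, h₂⟩, h₃, h₄⟩
      exact ⟨h₃ ▸ h₁, by omega⟩
    · rintro ⟨h₁, h₂⟩
      exact ⟨(⟨v.1 + k, by omega⟩, v.2), ⟨rfl, rfl⟩, h₁.symm, by simp only; omega⟩

theorem yval_pathAdj_noEdges {n p : ℕ} (u : ℕ → Fin p → ℝ) (k : ℕ) (v : Fin n × Fin p)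
    (h : (v.1 : ℕ) + k < n) :
    yval (cartAdj (pathAdj n) (noEdges p)) (fun v => u v.1 v.2) k v = u (v.1 + k) v.2 := by
  have hN : Nk (cartAdj (pathAdj n) (noEdges p)) k v = {(⟨v.1 + k, h⟩, v.2)} := by
    ext w
    simp [mem_Nk_pathAdj_noEdges, Prod.ext_iff, Fin.ext_iff, and_comm]
  simp [yval, hN]

theorem gdefined_pathAdj_noEdges {n p m : ℕ} (L : ℕ) (hm : 2 ≤ m) (v : Fin n × Fin p) :
    gdefined (cartAdj (pathAdj n) (noEdges p)) m L v ↔ (v.1 : ℕ) + (m - 1) * L < n := by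
  constructor
  · intro h
    obtain ⟨w, hw⟩ := h (m - 1) (mem_Icc.2 ⟨by omega, le_rfl⟩)
    have := ((mem_Nk_pathAdj_noEdges _ _ _).1 hw).2
    omega
  · intro h k hk
    have := Nat.mul_le_mul_right L (mem_Icc.1 hk).2
    exact ⟨(⟨v.1 + k * L, by omega⟩, v.2), (mem_Nk_pathAdj_noEdges _ _ _).2 ⟨rfl, rfl⟩⟩

theorem gembed_pathAdj_noEdges {n p m L : ℕ} (u : ℕ → Fin p → ℝ) (v : Fin n × Fin p)
    (h : (v.1 : ℕ) + (m - 1) * L < n) :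
    gembed (cartAdj (pathAdj n) (noEdges p)) (fun v => u v.1 v.2) m L v
      = tembed (fun t => u t v.2) m L v.1 := by
  funext k
  have := Nat.mul_le_mul_right L (show (k : ℕ) ≤ m - 1 by omega)
  exact yval_pathAdj_noEdges u _ v (by omega)

/-- The swap `(t, s) ↦ (s, t)` from vertices of `P⃗_n □ I_p` to channel-time pairs. -/
def channelTime (n p : ℕ) : Fin n × Fin p ↪ Fin p × ℕ where
  toFun v := (v.2, v.1)
  inj' v w h := by
    simpa [Prod.ext_iff, Fin.ext_iff, and_comm] using h

theorem channelTime_apply {n p : ℕ} (v : Fin n × Fin p) :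
    channelTime n p v = (v.2, (v.1 : ℕ)) :=
  rfl

theorem map_channelTime_filter_gdefined {n p m : ℕ} (L : ℕ) (hm : 2 ≤ m) :
    (univ.filter (gdefined (cartAdj (pathAdj n) (noEdges p)) m L)).map (channelTime n p)
      = univ ×ˢ range (n - (m - 1) * L) := by
  ext ⟨s, t⟩
  simp only [mem_map, mem_filter, mem_univ, true_and, gdefined_pathAdj_noEdges L hm,
    mem_product, mem_range, channelTime_apply, Prod.mk.injEq]
  constructor
  · rintro ⟨v, h, -, rfl⟩
    omega
  · intro h
    exact ⟨(⟨t, by omega⟩, s), by simp only; omega, rfl, rfl⟩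

theorem card_filter_gdefined {n p m : ℕ} (L : ℕ) (hm : 2 ≤ m) :
    (univ.filter (gdefined (cartAdj (pathAdj n) (noEdges p)) m L)).card
      = p * (n - (m - 1) * L) := by
  rw [← card_map (channelTime n p), map_channelTime_filter_gdefined L hm]
  simp

theorem card_filter_pattern {n p m : ℕ} (L : ℕ) (hm : 2 ≤ m) (u : ℕ → Fin p → ℝ)
    (π : Equiv.Perm (Fin m)) :
    ((univ.filter (gdefined (cartAdj (pathAdj n) (noEdges p)) m L)).filter
        (fun v => pattern (gembed (cartAdj (pathAdj n) (noEdges p))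
          (fun v : Fin n × Fin p => u v.1 v.2) m L v) = π)).card
      = ((univ ×ˢ range (n - (m - 1) * L)).filter
        (fun q : Fin p × ℕ => pattern (tembed (fun t => u t q.1) m L q.2) = π)).card := by
  rw [← map_channelTime_filter_gdefined L hm, filter_map, card_map]
  congr 1
  refine filter_congr fun v hv => ?_
  rw [gembed_pathAdj_noEdges u v
    ((gdefined_pathAdj_noEdges L hm v).1 (mem_filter.1 hv).2)]
  rfl

/-- If the interaction graph consists of `p` isolated vertices, then the
multivariate permutation entropy on `P⃗_n □ I_p` equals the multivariate multiscale
permutation entropy `MMSPE`. -/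
theorem mpe_isolated_eq_mmspe (n p m L : ℕ) (hm : 2 ≤ m) (hL : 1 ≤ L)
    (hn : (m - 1) * L < n) (u : ℕ → Fin p → ℝ) :
    PEG (cartAdj (pathAdj n) (noEdges p)) (fun v : Fin n × Fin p => u v.1 v.2) m L
      = MMSPE p u n m L := by
  simp only [PEG, MMSPE, card_filter_pattern L hm u, card_filter_gdefined L hm]
end

section
/- Let I_p be an undirected graph on p vertices, let x = (x_1, …, x_n) be a time series with n ≥ 2, and let U be the multivariate signal on the graph Ḡ = P⃗_n □ I_p in which every channel equals x, i.e. u_{t,s} = x_t for all t, s. Fix a vertex (i, j) of Ḡ with 1 ≤ i ≤ n−1. Then the 1-step neighborhood of (i, j) in Ḡ is N_1((i, j)) = {(i+1, j)} ∪ {(i, j') : j' adjacent to j in I_p}, the averaged value is y_{(i,j)}^1 = (x_{i+1} + d_j · x_i)/(d_j + 1), where d_j is the degree of j in I_p, and consequently the ordinal pattern (with m = 2, L = 1) of the embedding vector (u_{i,j}, y_{(i,j)}^1) at (i, j) in Ḡ equals the ordinal pattern of the embedding vector (x_i, x_{i+1}) at i in P⃗_n. -/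
open Finset

theorem pattern_congr {m : ℕ} {z w : Fin m → ℝ} (h : ∀ a b, z a ≤ z b ↔ w a ≤ w b) :
    pattern z = pattern w := by
  unfold pattern
  rw [Tuple.eq_sort_iff]
  obtain ⟨hmono, hties⟩ := Tuple.eq_sort_iff.1 (rfl : Tuple.sort z = Tuple.sort z)
  refine ⟨fun a b hab => (h _ _).1 (hmono hab), fun a b hab heq => hties a b hab ?_⟩
  exact le_antisymm ((h _ _).2 heq.le) ((h _ _).2 heq.ge)

section WalkNeighborhoods

variable {V : Type*} [Fintype V] [DecidableEq V]

theorem mem_Nk_one (A : V → V → Prop) [DecidableRel A] (v w : V) :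
    w ∈ Nk A 1 v ↔ A v w := by
  simp [Nk, stepSet]

theorem yval_zero (A : V → V → Prop) [DecidableRel A] (x : V → ℝ) (v : V) :
    yval A x 0 v = x v := by
  simp [yval, Nk]

end WalkNeighborhoods

theorem Nk_one_path_cart {n p : ℕ} (G : SimpleGraph (Fin p)) [DecidableRel G.Adj]
    (i : Fin n) (j : Fin p) (hi : (i : ℕ) + 1 < n) :
    Nk (cartAdj (pathAdj n) G.Adj) 1 (i, j)
        = {((⟨(i : ℕ) + 1, hi⟩ : Fin n), j)} ∪
            (G.neighborFinset j).image (fun j' => (i, j')) := by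
  ext ⟨a, b⟩
  simp only [mem_Nk_one, cartAdj, pathAdj, mem_union, mem_singleton, mem_image,
    SimpleGraph.mem_neighborFinset, Prod.mk.injEq, Fin.ext_iff]
  constructor
  · rintro (⟨h, hb⟩ | ⟨h, ha⟩)
    · exact Or.inr ⟨b, hb, h, rfl⟩
    · exact Or.inl ⟨ha.symm, h.symm⟩
  · rintro (⟨ha, hb⟩ | ⟨c, hc, ha, hb⟩)
    · exact Or.inr ⟨hb.symm, ha.symm⟩
    · exact Or.inl ⟨ha, Fin.ext hb ▸ hc⟩

theorem yval_one_path_cart {n p : ℕ} (G : SimpleGraph (Fin p)) [DecidableRel G.Adj]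
    (x : ℕ → ℝ) (i : Fin n) (j : Fin p) (hi : (i : ℕ) + 1 < n) :
    yval (cartAdj (pathAdj n) G.Adj) (fun v : Fin n × Fin p => x v.1) 1 (i, j)
        = (x ((i : ℕ) + 1) + (G.degree j : ℝ) * x i) / ((G.degree j : ℝ) + 1) := by
  have hinj : Function.Injective (fun j' : Fin p => (i, j')) := Prod.mk_right_injective i
  have hdisj : Disjoint {((⟨(i : ℕ) + 1, hi⟩ : Fin n), j)}
      ((G.neighborFinset j).image (fun j' => (i, j'))) := by
    simp [Fin.ext_iff]
  rw [yval, Nk_one_path_cart G i j hi, sum_union hdisj, card_union_of_disjoint hdisj,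
    sum_image hinj.injOn, card_image_of_injective _ hinj]
  simp [add_comm]

/-- On `Ḡ = P⃗_n □ I_p` with every channel equal to the time series `x`
(signal `(t,s) ↦ x t`, 0-based), for a vertex `(i,j)` with `i` not the last time index:
the 1-step neighbourhood is `{(i+1, j)} ∪ {(i, j') : j' ∼ j}`, the averaged value is
`y¹ = (x_{i+1} + d_j · x_i)/(d_j + 1)` where `d_j` is the degree of `j` in `I_p`,
and the ordinal pattern (m = 2, L = 1) of the embedding vector at `(i,j)` equals the
ordinal pattern of the classical embedding vector `(x_i, x_{i+1})` at `i`. -/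
theorem neighborhood_yval_pattern_in_product (n p : ℕ) (hn : 2 ≤ n)
    (G : SimpleGraph (Fin p)) [DecidableRel G.Adj] (x : ℕ → ℝ)
    (i : Fin n) (j : Fin p) (hi : (i : ℕ) + 1 < n) :
    Nk (cartAdj (pathAdj n) G.Adj) 1 (i, j)
        = {((⟨(i : ℕ) + 1, hi⟩ : Fin n), j)} ∪
            (G.neighborFinset j).image (fun j' => (i, j'))
    ∧ yval (cartAdj (pathAdj n) G.Adj) (fun v : Fin n × Fin p => x v.1) 1 (i, j)
        = (x ((i : ℕ) + 1) + (G.degree j : ℝ) * x i) / ((G.degree j : ℝ) + 1)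
    ∧ pattern (gembed (cartAdj (pathAdj n) G.Adj) (fun v : Fin n × Fin p => x v.1) 2 1 (i, j))
        = pattern (tembed x 2 1 i) := by
  refine ⟨Nk_one_path_cart G i j hi, yval_one_path_cart G x i j hi, pattern_congr ?_⟩
  have hd : (0 : ℝ) < (G.degree j : ℝ) + 1 := by positivity
  have h0 : gembed (cartAdj (pathAdj n) G.Adj) (fun v : Fin n × Fin p => x v.1) 2 1 (i, j) 0
      = x i := yval_zero _ _ _
  have h1 : gembed (cartAdj (pathAdj n) G.Adj) (fun v : Fin n × Fin p => x v.1) 2 1 (i, j) 1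
      = (x ((i : ℕ) + 1) + (G.degree j : ℝ) * x i) / ((G.degree j : ℝ) + 1) :=
    yval_one_path_cart G x i j hi
  have t0 : tembed x 2 1 i 0 = x i := rfl
  have t1 : tembed x 2 1 i 1 = x ((i : ℕ) + 1) := rfl
  simp only [Fin.forall_fin_two, h0, h1, t0, t1, le_refl, true_and, and_true]
  rw [le_div_iff₀ hd, div_le_iff₀ hd]
  constructor <;> constructor <;> intro h <;> linarith
end

section
/- Let I_p be an undirected graph on p vertices, let x = (x_1, …, x_n) be a time series with n ≥ 2, and let U be the multivariate signal on Ḡ = P⃗_n □ I_p in which every channel equals x (u_{t,s} = x_t). For embedding dimension m = 2 and delay L = 1, let π₁ = (1,2) and π₂ = (2,1) be the two ordinal patterns. Then the number of vertices of Ḡ whose embedding vector has pattern π₂ equals p times the number of indices i ∈ {1, …, n−1} with x_{i+1} < x_i, and the number of vertices of Ḡ whose embedding vector has pattern π₁ equals p times the number of indices i ∈ {1, …, n−1} with x_i ≤ x_{i+1}, plus q, where q is the number of non-isolated vertices of I_p. In particular, for each pattern the vertex counts in Ḡ and p times the counts in P⃗_n differ by at most p. -/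
open Finset

theorem pattern_eq_one_iff (z : Fin 2 → ℝ) : pattern z = 1 ↔ z 0 ≤ z 1 := by
  unfold pattern
  rw [Equiv.Perm.one_def, Tuple.sort_eq_refl_iff_monotone, Fin.monotone_iff_le_succ]
  simp

theorem perm_fin_two_eq_one_or_swap (π : Equiv.Perm (Fin 2)) :
    π = 1 ∨ π = Equiv.swap 0 1 := by
  revert π
  decide

theorem pattern_eq_swap_iff (z : Fin 2 → ℝ) : pattern z = Equiv.swap 0 1 ↔ z 1 < z 0 := by
  have hne : (1 : Equiv.Perm (Fin 2)) ≠ Equiv.swap 0 1 := by decide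
  rw [← not_le, ← pattern_eq_one_iff]
  rcases perm_fin_two_eq_one_or_swap (pattern z) with h | h
  · simp [h, hne]
  · simp [h, hne.symm]

section OneStep

variable {V : Type*} [Fintype V] [DecidableEq V] (A : V → V → Prop) [DecidableRel A]

theorem Nk_one (i : V) : Nk A 1 i = Finset.univ.filter (A i) := by
  simp [Nk, stepSet]

theorem gdefined_two_one_iff (i : V) : gdefined A 2 1 i ↔ ∃ j, A i j := by
  simp [gdefined, Nk_one, Finset.filter_nonempty_iff]

theorem gembed_two_one_zero (x : V → ℝ) (i : V) : gembed A x 2 1 i 0 = x i := by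
  simp [gembed, yval, Nk]

theorem gembed_two_one_one (x : V → ℝ) (i : V) :
    gembed A x 2 1 i 1 =
      (∑ j ∈ Finset.univ.filter (A i), x j) / ((Finset.univ.filter (A i)).card : ℝ) := by
  simp [gembed, yval, Nk_one]

/-- The neighbourhood average is at least the value at `i` iff the increments along the
arcs leaving `i` have nonnegative sum. -/
theorem gembed_zero_le_one_iff (x : V → ℝ) {i : V} (h : ∃ j, A i j) :
    gembed A x 2 1 i 0 ≤ gembed A x 2 1 i 1 ↔
      0 ≤ ∑ j ∈ Finset.univ.filter (A i), (x j - x i) := by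
  have hpos : (0 : ℝ) < ((Finset.univ.filter (A i)).card : ℝ) := by
    rw [Nat.cast_pos, Finset.card_pos, Finset.filter_nonempty_iff]
    simpa using h
  rw [gembed_two_one_zero, gembed_two_one_one, le_div_iff₀ hpos, Finset.sum_sub_distrib,
    Finset.sum_const, nsmul_eq_mul, sub_nonneg, mul_comm]

end OneStep

section PathProduct

variable {n p : ℕ} (G : SimpleGraph (Fin p)) [DecidableRel G.Adj] (x : ℕ → ℝ)

theorem exists_cartAdj_pathAdj_iff (v : Fin n × Fin p) :
    (∃ w, cartAdj (pathAdj n) G.Adj v w) ↔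
      (v.1 : ℕ) + 1 < n ∨ (G.neighborFinset v.2).Nonempty := by
  constructor
  · rintro ⟨w, ⟨-, h⟩ | ⟨-, h⟩⟩
    · exact Or.inr ⟨w.2, by simpa using h⟩
    · exact Or.inl (by have := w.1.isLt; unfold pathAdj at h; omega)
  · rintro (h | ⟨s, hs⟩)
    · exact ⟨(⟨v.1 + 1, h⟩, v.2), Or.inr ⟨rfl, rfl⟩⟩
    · exact ⟨(v.1, s), Or.inl ⟨rfl, by simpa using hs⟩⟩

theorem sum_increments_of_lt {v : Fin n × Fin p} (h : (v.1 : ℕ) + 1 < n) :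
    ∑ w ∈ Finset.univ.filter (cartAdj (pathAdj n) G.Adj v), (x w.1 - x v.1) =
      x (v.1 + 1) - x v.1 := by
  rw [Finset.sum_eq_single (⟨v.1 + 1, h⟩, v.2)]
  · rintro ⟨t, s⟩ hw hne
    rw [Finset.mem_filter] at hw
    rcases hw.2 with ⟨h1, -⟩ | ⟨h1, h2⟩
    · simp [h1]
    · have ht : t = ⟨v.1 + 1, h⟩ := Fin.ext (Eq.symm h2)
      exact (hne (Prod.mk.injEq _ _ _ _ ▸ ⟨ht, h1.symm⟩)).elim
  · intro hw
    refine absurd ?_ hw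
    rw [Finset.mem_filter]
    exact ⟨Finset.mem_univ _, Or.inr ⟨rfl, rfl⟩⟩

theorem sum_increments_of_not_lt {v : Fin n × Fin p} (h : ¬ (v.1 : ℕ) + 1 < n) :
    ∑ w ∈ Finset.univ.filter (cartAdj (pathAdj n) G.Adj v), (x w.1 - x v.1) = 0 := by
  refine Finset.sum_eq_zero fun w hw => ?_
  rw [Finset.mem_filter] at hw
  rcases hw.2 with ⟨h1, -⟩ | ⟨-, h2⟩
  · simp [h1]
  · have := w.1.isLt
    unfold pathAdj at h2
    omega

theorem defined_and_pattern_eq_one_iff (v : Fin n × Fin p) :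
    (gdefined (cartAdj (pathAdj n) G.Adj) 2 1 v ∧
      pattern (gembed (cartAdj (pathAdj n) G.Adj)
        (fun v : Fin n × Fin p => x v.1) 2 1 v) = 1) ↔
      ((v.1 : ℕ) + 1 < n ∧ x v.1 ≤ x (v.1 + 1)) ∨
        (¬ (v.1 : ℕ) + 1 < n ∧ (G.neighborFinset v.2).Nonempty) := by
  rw [gdefined_two_one_iff, pattern_eq_one_iff,
    and_congr_right (gembed_zero_le_one_iff _ (fun v : Fin n × Fin p => x v.1)),
    exists_cartAdj_pathAdj_iff]
  by_cases h : (v.1 : ℕ) + 1 < n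
  · simp [sum_increments_of_lt G x h, h]
  · simp [sum_increments_of_not_lt G x h, h]

theorem defined_and_pattern_eq_swap_iff (v : Fin n × Fin p) :
    (gdefined (cartAdj (pathAdj n) G.Adj) 2 1 v ∧
      pattern (gembed (cartAdj (pathAdj n) G.Adj)
        (fun v : Fin n × Fin p => x v.1) 2 1 v) = Equiv.swap 0 1) ↔
      (v.1 : ℕ) + 1 < n ∧ x (v.1 + 1) < x v.1 := by
  rw [gdefined_two_one_iff, pattern_eq_swap_iff, ← not_le,
    and_congr_right fun h => not_congr
      (gembed_zero_le_one_iff _ (fun v : Fin n × Fin p => x v.1) h),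
    exists_cartAdj_pathAdj_iff]
  by_cases h : (v.1 : ℕ) + 1 < n
  · simp [sum_increments_of_lt G x h, h]
  · simp [sum_increments_of_not_lt G x h, h]

end PathProduct

theorem card_filter_fin_succ_lt (n : ℕ) (P : ℕ → Prop) [DecidablePred P] :
    (Finset.univ.filter fun t : Fin n => (t : ℕ) + 1 < n ∧ P t).card =
      ((Finset.range (n - 1)).filter P).card := by
  rw [← Finset.card_map Fin.valEmbedding]
  congr 1
  ext i
  simp only [Finset.mem_map, Finset.mem_filter, Finset.mem_univ, true_and,
    Fin.valEmbedding_apply, Finset.mem_range]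
  constructor
  · rintro ⟨t, ⟨h, hP⟩, rfl⟩
    exact ⟨by omega, hP⟩
  · rintro ⟨h, hP⟩
    exact ⟨⟨i, by omega⟩, ⟨by simp only; omega, hP⟩, rfl⟩

theorem card_filter_last {n : ℕ} (hn : 0 < n) :
    (Finset.univ.filter fun t : Fin n => ¬ (t : ℕ) + 1 < n).card = 1 := by
  rw [Finset.card_eq_one]
  refine ⟨⟨n - 1, by omega⟩, ?_⟩
  ext t
  simp only [Finset.mem_filter, Finset.mem_univ, true_and, Finset.mem_singleton, Fin.ext_iff]
  omega

section Counts

variable {n p : ℕ} (G : SimpleGraph (Fin p)) [DecidableRel G.Adj] (x : ℕ → ℝ)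

theorem card_pattern_eq_swap :
    ((Finset.univ.filter (gdefined (cartAdj (pathAdj n) G.Adj) 2 1)).filter
        (fun v : Fin n × Fin p =>
          pattern (gembed (cartAdj (pathAdj n) G.Adj)
            (fun v : Fin n × Fin p => x v.1) 2 1 v) = Equiv.swap 0 1)).card
      = p * ((Finset.range (n - 1)).filter (fun i => x (i + 1) < x i)).card := by
  rw [Finset.filter_filter, Finset.filter_congr fun v _ => defined_and_pattern_eq_swap_iff G x v,
    ← Finset.univ_product_univ,
    Finset.filter_product_left fun t : Fin n => (t : ℕ) + 1 < n ∧ x (t + 1) < x t,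
    Finset.card_product, card_filter_fin_succ_lt n fun i => x (i + 1) < x i,
    Finset.card_univ, Fintype.card_fin, mul_comm]

theorem card_pattern_eq_one (hn : 0 < n) :
    ((Finset.univ.filter (gdefined (cartAdj (pathAdj n) G.Adj) 2 1)).filter
        (fun v : Fin n × Fin p =>
          pattern (gembed (cartAdj (pathAdj n) G.Adj)
            (fun v : Fin n × Fin p => x v.1) 2 1 v) = 1)).card
      = p * ((Finset.range (n - 1)).filter (fun i => x i ≤ x (i + 1))).card
          + (Finset.univ.filter (fun j : Fin p => (G.neighborFinset j).Nonempty)).card := by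
  have hdisj : Disjoint
      (Finset.univ.filter fun v : Fin n × Fin p => (v.1 : ℕ) + 1 < n ∧ x v.1 ≤ x (v.1 + 1))
      (Finset.univ.filter fun v : Fin n × Fin p =>
        ¬ (v.1 : ℕ) + 1 < n ∧ (G.neighborFinset v.2).Nonempty) :=
    Finset.disjoint_filter.2 fun _ _ h h' => h'.1 h.1
  rw [Finset.filter_filter, Finset.filter_congr fun v _ => defined_and_pattern_eq_one_iff G x v,
    Finset.filter_or, Finset.card_union_of_disjoint hdisj, ← Finset.univ_product_univ,
    Finset.filter_product_left fun t : Fin n => (t : ℕ) + 1 < n ∧ x t ≤ x (t + 1),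
    Finset.filter_product (fun t : Fin n => ¬ (t : ℕ) + 1 < n)
      fun s : Fin p => (G.neighborFinset s).Nonempty,
    Finset.card_product, Finset.card_product,
    card_filter_fin_succ_lt n fun i => x i ≤ x (i + 1), card_filter_last hn,
    Finset.card_univ, Fintype.card_fin, mul_comm, one_mul]

end Counts

/-- On `Ḡ = P⃗_n □ I_p` with every channel equal to the time series `x`
(0-based), for `m = 2`, `L = 1`: the number of vertices with pattern `π₂ = (2,1)` (i.e.
`Equiv.swap 0 1`) equals `p` times the number of descents `x_{i+1} < x_i`; the number of
vertices with pattern `π₁ = (1,2)` (the identity) equals `p` times the number of ascents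
`x_i ≤ x_{i+1}` plus the number `q` of non-isolated vertices of `I_p`. In particular, for
each pattern the count in `Ḡ` and `p` times the count in `P⃗_n` differ by at most `p`. -/
theorem pattern_counts_in_product (n p : ℕ) (hn : 2 ≤ n)
    (G : SimpleGraph (Fin p)) [DecidableRel G.Adj] (x : ℕ → ℝ) :
    ((Finset.univ.filter (gdefined (cartAdj (pathAdj n) G.Adj) 2 1)).filter
        (fun v : Fin n × Fin p =>
          pattern (gembed (cartAdj (pathAdj n) G.Adj)
            (fun v : Fin n × Fin p => x v.1) 2 1 v) = Equiv.swap 0 1)).card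
      = p * ((Finset.range (n - 1)).filter (fun i => x (i + 1) < x i)).card
    ∧ ((Finset.univ.filter (gdefined (cartAdj (pathAdj n) G.Adj) 2 1)).filter
        (fun v : Fin n × Fin p =>
          pattern (gembed (cartAdj (pathAdj n) G.Adj)
            (fun v : Fin n × Fin p => x v.1) 2 1 v) = 1)).card
      = p * ((Finset.range (n - 1)).filter (fun i => x i ≤ x (i + 1))).card
          + (Finset.univ.filter (fun j : Fin p => (G.neighborFinset j).Nonempty)).card
    ∧ ∀ π : Equiv.Perm (Fin 2),
        abs ((((Finset.univ.filter (gdefined (cartAdj (pathAdj n) G.Adj) 2 1)).filter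
            (fun v : Fin n × Fin p =>
              pattern (gembed (cartAdj (pathAdj n) G.Adj)
                (fun v : Fin n × Fin p => x v.1) 2 1 v) = π)).card : ℤ)
          - (p : ℤ) * (((Finset.range (n - 1)).filter
              (fun i => pattern (tembed x 2 1 i) = π)).card : ℤ)) ≤ (p : ℤ) := by
  refine ⟨card_pattern_eq_swap G x, card_pattern_eq_one G x (by omega), fun π => ?_⟩
  rcases perm_fin_two_eq_one_or_swap π with rfl | rfl
  · have hq : (Finset.univ.filter fun j : Fin p => (G.neighborFinset j).Nonempty).card ≤ p :=
      (Finset.card_le_univ _).trans_eq (Fintype.card_fin p)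
    rw [card_pattern_eq_one G x (by omega)]
    simp only [pattern_eq_one_iff, tembed]
    simpa using hq
  · rw [card_pattern_eq_swap G x]
    simp only [pattern_eq_swap_iff, tembed]
    simp
end

section
/- Let x = (x_1, …, x_n) be a time series and let G = P⃗_n be the directed path on n vertices. Then for every embedding dimension m ≥ 2 and delay L ≥ 1 with n > (m−1)L, the permutation entropy of x as a graph signal on P⃗_n equals its classical permutation entropy: PE_G(x; m, L) = PE(x; m, L). -/
open Finset

theorem mem_Nk_pathAdj {n : ℕ} (k : ℕ) (i j : Fin n) :
    j ∈ Nk (pathAdj n) k i ↔ (i : ℕ) + k = j := by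
  induction k generalizing j with
  | zero => simp [Nk, Fin.ext_iff, eq_comm]
  | succ k ih =>
    have hstep : Nk (pathAdj n) (k + 1) i = stepSet (pathAdj n) (Nk (pathAdj n) k i) :=
      Function.iterate_succ_apply' _ _ _
    simp only [hstep, stepSet, mem_biUnion, mem_filter, mem_univ, true_and, ih, pathAdj]
    constructor
    · rintro ⟨v, hv, hj⟩
      omega
    · intro h
      exact ⟨⟨i + k, by omega⟩, rfl, by simp only; omega⟩

theorem Nk_pathAdj_eq_singleton {n : ℕ} (k : ℕ) (i : Fin n) (h : (i : ℕ) + k < n) :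
    Nk (pathAdj n) k i = {⟨i + k, h⟩} := by
  ext j
  simp [mem_Nk_pathAdj, Fin.ext_iff, eq_comm]

theorem Nk_pathAdj_nonempty {n : ℕ} (k : ℕ) (i : Fin n) :
    (Nk (pathAdj n) k i).Nonempty ↔ (i : ℕ) + k < n := by
  refine ⟨fun ⟨j, hj⟩ => ?_, fun h => ⟨⟨i + k, h⟩, (mem_Nk_pathAdj _ _ _).2 rfl⟩⟩
  rw [mem_Nk_pathAdj] at hj
  omega

theorem gdefined_pathAdj {n m : ℕ} (L : ℕ) (hm : 2 ≤ m) (i : Fin n) :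
    gdefined (pathAdj n) m L i ↔ (i : ℕ) + (m - 1) * L < n := by
  simp only [gdefined, Nk_pathAdj_nonempty, mem_Icc]
  refine ⟨fun h => h _ ⟨by omega, le_rfl⟩, fun h k hk => ?_⟩
  have := Nat.mul_le_mul_right L hk.2
  omega

theorem gembed_pathAdj {n m L : ℕ} (x : ℕ → ℝ) (i : Fin n) (h : (i : ℕ) + (m - 1) * L < n) :
    gembed (pathAdj n) (fun v : Fin n => x v) m L i = tembed x m L i := by
  funext k
  have hk : (k : ℕ) * L ≤ (m - 1) * L := Nat.mul_le_mul_right L (by omega)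
  simp [gembed, yval, tembed, Nk_pathAdj_eq_singleton _ i (by omega : (i : ℕ) + k * L < n)]

theorem map_filter_gdefined_pathAdj {n m : ℕ} (L : ℕ) (hm : 2 ≤ m) :
    (univ.filter (gdefined (pathAdj n) m L)).map Fin.valEmbedding =
      range (n - (m - 1) * L) := by
  ext a
  simp only [mem_map, mem_filter, mem_univ, true_and, gdefined_pathAdj L hm, mem_range,
    Fin.valEmbedding_apply]
  constructor
  · rintro ⟨i, hi, rfl⟩
    omega
  · intro h
    exact ⟨⟨a, by omega⟩, by simp only; omega, rfl⟩

theorem card_filter_pattern_pathAdj {n m : ℕ} (L : ℕ) (hm : 2 ≤ m) (x : ℕ → ℝ)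
    (π : Equiv.Perm (Fin m)) :
    ((univ.filter (gdefined (pathAdj n) m L)).filter
        (fun i => pattern (gembed (pathAdj n) (fun v : Fin n => x v) m L i) = π)).card =
      ((range (n - (m - 1) * L)).filter (fun i => pattern (tembed x m L i) = π)).card := by
  rw [← map_filter_gdefined_pathAdj L hm, filter_map, card_map]
  congr 1
  refine filter_congr fun i hi => ?_
  rw [gembed_pathAdj x i ((gdefined_pathAdj L hm i).1 (mem_filter.1 hi).2)]
  rfl

/-- For a time series `x_0, …, x_{n-1}` viewed as a graph signal on the
directed path `P⃗_n`, the permutation entropy for graph signals coincides with the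
classical permutation entropy: `PE_G(x; m, L) = PE(x; m, L)`. -/
theorem peg_path_eq_pe (n m L : ℕ) (hm : 2 ≤ m) (hL : 1 ≤ L)
    (hn : (m - 1) * L < n) (x : ℕ → ℝ) :
    PEG (pathAdj n) (fun v : Fin n => x v) m L = PE x n m L := by
  have hcard : (univ.filter (gdefined (pathAdj n) m L)).card = n - (m - 1) * L := by
    rw [← card_map Fin.valEmbedding, map_filter_gdefined_pathAdj L hm, card_range]
  simp only [PEG, PE, card_filter_pattern_pathAdj L hm, hcard]
end
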